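/- Let Ψ : ℳ → ℳ be multiplicative and degree-preserving, with Ψ[p] ∈ 𝒫 for every p ∈ 𝒫, and suppose the restriction of Ψ to 𝒫 is support-preserving. Define γ > 0 by Ψ[(X+1)/2] = (X+γ)/(1+γ). Then for all reals 0 < a < b, Ψ[(X²−aX+ab)/(1−a+ab)] = (X²−γaX+γ²ab)/(1−γa+γ²ab). -/

import Mathlib

open Polynomial

/-- `Pset` is the set of real polynomials with nonnegative coefficients summing to 1. -/
def Pset : Set (Polynomial ℝ) := {p | (∀ k, 0 ≤ p.coeff k) ∧ p.eval 1 = 1}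

/-- `Mset` is the set of real polynomials `p` with `p(1) = 1` that are positive on the
positive reals. -/
def Mset : Set (Polynomial ℝ) := {p | p.eval 1 = 1 ∧ ∀ x : ℝ, 0 < x → 0 < p.eval x}

/-- The normalized linear polynomial `(X + a)/(1 + a)`. -/
noncomputable def lin (a : ℝ) : Polynomial ℝ := C (1 + a)⁻¹ * (X + C a)

/-- The normalized quadratic `(X² - aX + ab)/(1 - a + ab)`. -/
noncomputable def normQuad (a b : ℝ) : Polynomial ℝ :=
  C (1 - a + a * b)⁻¹ * (X ^ 2 - C a * X + C (a * b))

/-- A positive additive function on the positive reals is linear. -/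
lemma eq_mul_of_additive_of_pos {f : ℝ → ℝ} (hpos : ∀ x, 0 < x → 0 < f x)
    (hadd : ∀ x y, 0 < x → 0 < y → f (x + y) = f x + f y) {x : ℝ} (hx : 0 < x) :
    f x = f 1 * x := by
  have hnat : ∀ (n : ℕ) (y : ℝ), 0 < y → f ((n + 1 : ℕ) * y) = (n + 1 : ℕ) * f y := by
    intro n y hy
    induction n with
    | zero => simp
    | succ n ih =>
      have h : ((n + 1 + 1 : ℕ) : ℝ) * y = ((n + 1 : ℕ) : ℝ) * y + y := by push_cast; ring
      rw [h, hadd _ _ (by positivity) hy, ih]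
      push_cast; ring
  have hmono : ∀ y z, 0 < y → y ≤ z → f y ≤ f z := by
    intro y z hy hyz
    rcases hyz.eq_or_lt with rfl | h
    · exact le_rfl
    · have h1 := hadd y (z - y) hy (by linarith)
      rw [add_sub_cancel] at h1
      linarith [hpos (z - y) (by linarith)]
  have hbound : ∀ n : ℕ, ((n + 1 : ℕ) : ℝ) * |f x - f 1 * x| ≤ f 1 := by
    intro n
    have hf1 := hpos 1 one_pos
    have hnx : 0 < ((n + 1 : ℕ) : ℝ) * x := by positivity
    have hfx := hnat n x hx
    have hupper := hmono _ _ hnx (Nat.lt_floor_add_one (((n + 1 : ℕ) : ℝ) * x)).le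
    have hfloor := Nat.floor_le hnx.le
    have hlt := Nat.lt_floor_add_one (((n + 1 : ℕ) : ℝ) * x)
    have hlower : (⌊((n + 1 : ℕ) : ℝ) * x⌋₊ : ℝ) * f 1 ≤ f (((n + 1 : ℕ) : ℝ) * x) := by
      generalize ⌊((n + 1 : ℕ) : ℝ) * x⌋₊ = m at hfloor
      cases m with
      | zero => simpa using (hpos _ hnx).le
      | succ m =>
        have h1 := hnat m 1 one_pos
        rw [mul_one] at h1
        rw [← h1]
        exact hmono _ _ (by positivity) hfloor
    have hsucc := hnat ⌊((n + 1 : ℕ) : ℝ) * x⌋₊ 1 one_pos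
    rw [mul_one, Nat.cast_succ] at hsucc
    rw [hsucc, hfx] at hupper
    rw [hfx] at hlower
    have habs : ((n + 1 : ℕ) : ℝ) * |f x - f 1 * x| =
        |((n + 1 : ℕ) : ℝ) * f x - ((n + 1 : ℕ) : ℝ) * x * f 1| := by
      rw [← abs_of_pos (show (0 : ℝ) < ((n + 1 : ℕ) : ℝ) by positivity), ← abs_mul,
        abs_of_pos (show (0 : ℝ) < ((n + 1 : ℕ) : ℝ) by positivity)]
      ring_nf
    rw [habs, abs_le]
    constructor <;> nlinarith
  by_contra hne
  have hd : 0 < |f x - f 1 * x| := abs_pos.mpr (sub_ne_zero.mpr hne)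
  obtain ⟨n, hn⟩ := exists_nat_gt (f 1 / |f x - f 1 * x|)
  rw [div_lt_iff₀ hd] at hn
  have h := hbound n
  push_cast at h
  linarith

lemma coeff_quartic_nonneg {K e₀ e₁ e₂ e₃ e₄ : ℝ} (hK : 0 ≤ K) (h₀ : 0 ≤ e₀) (h₁ : 0 ≤ e₁)
    (h₂ : 0 ≤ e₂) (h₃ : 0 ≤ e₃) (h₄ : 0 ≤ e₄) (k : ℕ) :
    0 ≤ (C K * (C e₄ * X ^ 4 + C e₃ * X ^ 3 + C e₂ * X ^ 2 + C e₁ * X + C e₀)).coeff k := by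
  simp only [coeff_C_mul, coeff_add, coeff_X_pow, coeff_X, coeff_C]
  apply mul_nonneg hK
  split_ifs <;> simp <;> positivity

lemma lin_mem_Mset {a : ℝ} (ha : 0 < a) : lin a ∈ Mset := by
  refine ⟨?_, fun x hx => ?_⟩
  · simp only [lin, eval_mul, eval_C, eval_add, eval_X]
    exact inv_mul_cancel₀ (by positivity)
  · simp only [lin, eval_mul, eval_C, eval_add, eval_X]
    positivity

lemma lin_mem_Pset {a : ℝ} (ha : 0 < a) : lin a ∈ Pset := by
  refine ⟨fun k => ?_, (lin_mem_Mset ha).1⟩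
  have h := coeff_quartic_nonneg (K := (1 + a)⁻¹) (by positivity) ha.le zero_le_one
    (le_refl (0 : ℝ)) (le_refl (0 : ℝ)) (le_refl (0 : ℝ)) k
  simpa [lin] using h

lemma degree_lin {a : ℝ} (ha : 0 < a) : (lin a).degree = 1 := by
  rw [lin, degree_C_mul (by positivity), degree_X_add_C]

lemma normQuad_normalizer_pos {a b : ℝ} (ha : 0 < a) (hab : a < b) : 0 < 1 - a + a * b := by
  nlinarith [sq_nonneg (a - 1), mul_pos ha (sub_pos.mpr hab)]

lemma normQuad_mem_Mset {a b : ℝ} (ha : 0 < a) (hab : a < b) : normQuad a b ∈ Mset := by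
  have hK := normQuad_normalizer_pos ha hab
  refine ⟨?_, fun x hx => ?_⟩
  · simp only [normQuad, eval_mul, eval_C, eval_add, eval_sub, eval_X, eval_pow, one_pow, mul_one]
    exact inv_mul_cancel₀ hK.ne'
  · simp only [normQuad, eval_mul, eval_C, eval_add, eval_sub, eval_X, eval_pow]
    exact mul_pos (inv_pos.mpr hK)
      (by nlinarith [sq_nonneg (2 * x - a), mul_pos ha (sub_pos.mpr hab)])

lemma degree_normQuad {a b : ℝ} (ha : 0 < a) (hab : a < b) : (normQuad a b).degree = 2 := by
  have hK := normQuad_normalizer_pos ha hab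
  rw [normQuad, degree_C_mul (inv_ne_zero hK.ne')]
  compute_degree!

lemma mul_mem_Mset {p q : Polynomial ℝ} (hp : p ∈ Mset) (hq : q ∈ Mset) : p * q ∈ Mset :=
  ⟨by rw [eval_mul, hp.1, hq.1, one_mul], fun x hx => by
    rw [eval_mul]; exact mul_pos (hp.2 x hx) (hq.2 x hx)⟩

lemma eq_lin_of_degree_eq_one {p : Polynomial ℝ} (hp : p.degree = 1) (h1 : p.eval 1 = 1)
    (hlead : 0 < p.coeff 1) : p = lin (p.coeff 0 / p.coeff 1) := by
  have hexp := eq_X_add_C_of_degree_le_one hp.le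
  have hsum : p.coeff 1 + p.coeff 0 = 1 := by
    rw [hexp] at h1
    simpa using h1
  have hinv : (1 + p.coeff 0 / p.coeff 1)⁻¹ = p.coeff 1 := by
    rw [one_add_div hlead.ne', hsum, one_div, inv_inv]
  conv_lhs => rw [hexp]
  rw [lin, hinv, mul_add, ← C_mul, mul_div_cancel₀ _ hlead.ne']

lemma lin_mul_normQuad (c a b : ℝ) :
    lin c * normQuad a b = C ((1 + c)⁻¹ * (1 - a + a * b)⁻¹) *
      (C 0 * X ^ 4 + C 1 * X ^ 3 + C (c - a) * X ^ 2 + C (a * b - a * c) * X +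
        C (c * (a * b))) := by
  simp only [lin, normQuad, C_mul, C_sub, C_0, C_1]
  ring

lemma lin_mul_lin_mul_normQuad (c d a b : ℝ) :
    lin c * (lin d * normQuad a b) = C ((1 + c)⁻¹ * ((1 + d)⁻¹ * (1 - a + a * b)⁻¹)) *
      (C 1 * X ^ 4 + C (c + d - a) * X ^ 3 + C (c * d - a * (c + d) + a * b) * X ^ 2 +
        C (a * b * (c + d) - a * (c * d)) * X + C (c * d * (a * b))) := by
  simp only [lin, normQuad, C_mul, C_sub, C_add, C_1]
  ring

lemma lin_mul_normQuad_mem_Pset {a b c : ℝ} (ha : 0 < a) (hab : a < b) (hac : a ≤ c)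
    (hcb : c ≤ b) : lin c * normQuad a b ∈ Pset := by
  have hK := normQuad_normalizer_pos ha hab
  have hc : 0 < c := by linarith
  have hb : 0 < b := by linarith
  refine ⟨?_, (mul_mem_Mset (lin_mem_Mset hc) (normQuad_mem_Mset ha hab)).1⟩
  rw [lin_mul_normQuad]
  exact coeff_quartic_nonneg (by positivity) (by positivity) (by nlinarith) (by linarith)
    zero_le_one le_rfl

lemma lin_mul_lin_mul_normQuad_mem_Pset {c d : ℝ} (hc : 0 < c) (hd : 0 < d) :
    lin c * (lin d * normQuad (c + d) (2 * (c + d))) ∈ Pset := by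
  have ha : 0 < c + d := by positivity
  have hab : c + d < 2 * (c + d) := by linarith
  have hK := normQuad_normalizer_pos ha hab
  have hcd := mul_pos hc hd
  refine ⟨?_, (mul_mem_Mset (lin_mem_Mset hc)
    (mul_mem_Mset (lin_mem_Mset hd) (normQuad_mem_Mset ha hab))).1⟩
  rw [lin_mul_lin_mul_normQuad]
  refine coeff_quartic_nonneg (by positivity) (by positivity) ?_ ?_ (by linarith) zero_le_one
  · have : (c + d) * (2 * (c + d)) * (c + d) - (c + d) * (c * d) =
        (c + d) * (2 * c ^ 2 + 3 * (c * d) + 2 * d ^ 2) := by ring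
    rw [this]; positivity
  · nlinarith [sq_nonneg (c + d)]

theorem stmt_12 (Ψ : Polynomial ℝ → Polynomial ℝ)
    (hmapM : ∀ q ∈ Mset, Ψ q ∈ Mset)
    (hmul : ∀ p ∈ Mset, ∀ q ∈ Mset, Ψ (p * q) = Ψ p * Ψ q)
    (hdeg : ∀ q ∈ Mset, (Ψ q).degree = q.degree)
    (hmapP : ∀ p ∈ Pset, Ψ p ∈ Pset)
    (hsupp : ∀ p ∈ Pset, ∀ k : ℕ, 0 < (Ψ p).coeff k ↔ 0 < p.coeff k)
    (γ : ℝ) (hγ : 0 < γ) (hfix : Ψ (lin 1) = lin γ) :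
    ∀ a b : ℝ, 0 < a → a < b →
      Ψ (C (1 - a + a * b)⁻¹ * (X ^ 2 - C a * X + C (a * b))) =
        C (1 - γ * a + γ ^ 2 * (a * b))⁻¹ *
          (X ^ 2 - C (γ * a) * X + C (γ ^ 2 * (a * b))) := by
  have hzero : ∀ p ∈ Pset, ∀ k, p.coeff k = 0 → (Ψ p).coeff k = 0 := fun p hp k hk =>
    le_antisymm (not_lt.mp fun h => ((hsupp p hp k).mp h).ne' hk) ((hmapP p hp).1 k)
  set ψ : ℝ → ℝ := fun a => (Ψ (lin a)).coeff 0 / (Ψ (lin a)).coeff 1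
  have hcoeff : ∀ a, 0 < a → 0 < (Ψ (lin a)).coeff 0 ∧ 0 < (Ψ (lin a)).coeff 1 := by
    intro a ha
    have ha' : 0 < (1 + a)⁻¹ := by positivity
    rw [hsupp _ (lin_mem_Pset ha), hsupp _ (lin_mem_Pset ha)]
    simp only [lin, coeff_C_mul, coeff_add, coeff_X_zero, coeff_X_one, coeff_C_zero,
      coeff_C_succ, zero_add, add_zero, mul_one]
    exact ⟨mul_pos ha' ha, ha'⟩
  have hψpos : ∀ a, 0 < a → 0 < ψ a := fun a ha => div_pos (hcoeff a ha).1 (hcoeff a ha).2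
  have hlin : ∀ a, 0 < a → Ψ (lin a) = lin (ψ a) := fun a ha =>
    eq_lin_of_degree_eq_one ((hdeg _ (lin_mem_Mset ha)).trans (degree_lin ha))
      (hmapM _ (lin_mem_Mset ha)).1 (hcoeff a ha).2
  have hψ1 : ψ 1 = γ := by
    have h : (1 + γ) ≠ 0 := by positivity
    change (Ψ (lin 1)).coeff 0 / (Ψ (lin 1)).coeff 1 = γ
    simp only [hfix]
    simp only [lin, coeff_C_mul, coeff_add, coeff_X_zero, coeff_X_one, coeff_C_zero,
      coeff_C_succ, zero_add, add_zero, mul_one]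
    field_simp
  have hquad : ∀ a b, 0 < a → a < b → 1 - ψ a + ψ a * ψ b ≠ 0 ∧
      Ψ (normQuad a b) = normQuad (ψ a) (ψ b) := by
    intro a b ha hab
    have hb := ha.trans hab
    have hM := normQuad_mem_Mset ha hab
    have hd := (hdeg _ hM).trans (degree_normQuad ha hab)
    have heval := (hmapM _ hM).1
    have hq := eq_quadratic_of_degree_le_two hd.le
    set q := Ψ (normQuad a b) with hqdef
    have hprod : ∀ c, 0 < c → Ψ (lin c * normQuad a b) = C (1 + ψ c)⁻¹ *
        (C (q.coeff 2) * X ^ 3 + C (q.coeff 1 + ψ c * q.coeff 2) * X ^ 2 +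
          C (q.coeff 0 + ψ c * q.coeff 1) * X + C (ψ c * q.coeff 0)) := by
      intro c hc
      rw [hmul _ (lin_mem_Mset hc) _ hM, hlin c hc, ← hqdef]
      conv_lhs => rw [hq]
      simp only [lin, C_mul, C_add]
      ring
    have hinv : ∀ c, 0 < c → (1 + ψ c)⁻¹ ≠ 0 := fun c hc =>
      inv_ne_zero (by linarith [hψpos c hc])
    have h2 := hzero _ (lin_mul_normQuad_mem_Pset ha hab le_rfl hab.le) 2 (by
      rw [lin_mul_normQuad]; simp only [coeff_C_mul, coeff_add, coeff_X_pow, coeff_X, coeff_C]; norm_num)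
    have h1 := hzero _ (lin_mul_normQuad_mem_Pset ha hab hab.le le_rfl) 1 (by
      rw [lin_mul_normQuad]; simp only [coeff_C_mul, coeff_add, coeff_X_pow, coeff_X, coeff_C]; norm_num)
    rw [hprod a ha, coeff_C_mul, mul_eq_zero_iff_left (hinv a ha)] at h2
    rw [hprod b hb, coeff_C_mul, mul_eq_zero_iff_left (hinv b hb)] at h1
    simp only [coeff_add, coeff_C_mul, coeff_X_pow, coeff_X, coeff_C] at h1 h2
    norm_num at h1 h2
    have hq1 : q.coeff 1 = -(ψ a * q.coeff 2) := by linarith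
    have hq0 : q.coeff 0 = ψ a * ψ b * q.coeff 2 := by rw [hq1] at h1; linarith
    have hk : q.coeff 2 * (1 - ψ a + ψ a * ψ b) = 1 := by
      rw [hq] at heval
      simp only [eval_add, eval_mul, eval_C, eval_pow, eval_X] at heval
      rw [hq1, hq0] at heval
      linarith
    refine ⟨right_ne_zero_of_mul_eq_one hk, ?_⟩
    rw [hq1, hq0] at hq
    rw [normQuad, ← eq_inv_of_mul_eq_one_left hk]
    refine hq.trans ?_
    simp only [C_mul, C_neg]
    ring
  have hadd : ∀ c d, 0 < c → 0 < d → ψ (c + d) = ψ c + ψ d := by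
    intro c d hc hd
    have ha : 0 < c + d := by positivity
    have hab : c + d < 2 * (c + d) := by linarith
    have hM := normQuad_mem_Mset ha hab
    obtain ⟨hne, hq⟩ := hquad _ _ ha hab
    have h := hzero _ (lin_mul_lin_mul_normQuad_mem_Pset hc hd) 3 (by
      rw [lin_mul_lin_mul_normQuad]; simp only [coeff_C_mul, coeff_add, coeff_X_pow, coeff_X, coeff_C]; norm_num)
    have hK : (1 + ψ c)⁻¹ * ((1 + ψ d)⁻¹ *
        (1 - ψ (c + d) + ψ (c + d) * ψ (2 * (c + d)))⁻¹) ≠ 0 := by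
      have h1 := hψpos c hc
      have h2 := hψpos d hd
      exact mul_ne_zero (by positivity) (mul_ne_zero (by positivity) (inv_ne_zero hne))
    rw [hmul _ (lin_mem_Mset hc) _ (mul_mem_Mset (lin_mem_Mset hd) hM),
      hmul _ (lin_mem_Mset hd) _ hM, hlin c hc, hlin d hd, hq, lin_mul_lin_mul_normQuad,
      coeff_C_mul, mul_eq_zero_iff_left hK] at h
    simp only [coeff_add, coeff_C_mul, coeff_X_pow, coeff_X, coeff_C] at h
    norm_num at h
    linarith
  have hψlin : ∀ a, 0 < a → ψ a = γ * a := fun a ha => by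
    rw [eq_mul_of_additive_of_pos hψpos hadd ha, hψ1]
  intro a b ha hab
  have h := (hquad a b ha hab).2
  rw [hψlin a ha, hψlin b (ha.trans hab)] at h
  rw [normQuad, normQuad, show γ * a * (γ * b) = γ ^ 2 * (a * b) by ring] at h
  exact h
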